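/- Let r ≥ 2 and let q_{ij} ≥ 0 be given nonnegative real numbers for all ordered pairs (i, j) with i, j ∈ {1, …, r}, i ≠ j. Then there exist positive real numbers α_1, …, α_r with α_i · q_{ij} < α_j for all i ≠ j if and only if for every integer n ≥ 2 and every cyclic sequence i_1, …, i_n ∈ {1, …, r} with i_s ≠ i_{s+1} for all s (indices taken cyclically, i_{n+1} = i_1), one has ∏_{s=1}^{n} q_{i_s i_{s+1}} < 1. -/

import Mathlib

/-- Weighted walks inside `S`, with the product of the coefficients along the walk. -/
inductive BWalk {ι : Type} (S : Finset ι) (q : ι → ι → ℝ) : ι → ι → ℝ → Prop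
  | single {i j : ι} (hi : i ∈ S) (hj : j ∈ S) (h : i ≠ j) : BWalk S q i j (q i j)
  | cons {i j k : ι} {w : ℝ} (hi : i ∈ S) (hj : j ∈ S) (h : i ≠ j) (hw : BWalk S q j k w) :
      BWalk S q i k (q i j * w)

theorem BWalk.nonneg {ι : Type} {S : Finset ι} {q : ι → ι → ℝ}
    (hq : ∀ i j, i ≠ j → 0 ≤ q i j) {i j : ι} {w : ℝ} (h : BWalk S q i j w) : 0 ≤ w := by
  induction h with
  | single hi hj h => exact hq _ _ h
  | cons hi hj h _ ih => exact mul_nonneg (hq _ _ h) ih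

theorem BWalk.elim_vertex {ι : Type} [DecidableEq ι] {T : Finset ι} {q : ι → ι → ℝ} {v : ι}
    (hv : v ∉ T) (hq : ∀ i j, i ≠ j → 0 ≤ q i j) {i j : ι} {w : ℝ}
    (h : BWalk T (fun i j => max (q i j) (q i v * q v j)) i j w) :
    ∃ w', w ≤ w' ∧ BWalk (insert v T) q i j w' := by
  induction h with
  | @single i j hi hj h =>
    have hiv : i ≠ v := fun e => hv (e ▸ hi)
    have hjv : v ≠ j := fun e => hv (e ▸ hj)
    rcases le_total (q i j) (q i v * q v j) with hle | hle
    · exact ⟨q i v * q v j, by simp [hle],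
        .cons (by simp [hi]) (by simp) hiv (.single (by simp) (by simp [hj]) hjv)⟩
    · exact ⟨q i j, by simp [hle], .single (by simp [hi]) (by simp [hj]) h⟩
  | @cons i j k w hi hj h hw ih =>
    obtain ⟨w', hle', hw'⟩ := ih
    have hiv : i ≠ v := fun e => hv (e ▸ hi)
    have hjv : v ≠ j := fun e => hv (e ▸ hj)
    rcases le_total (q i j) (q i v * q v j) with hle | hle
    · refine ⟨q i v * (q v j * w'), ?_,
        .cons (by simp [hi]) (by simp) hiv (.cons (by simp) (by simp [hj]) hjv hw')⟩
      simp only [max_eq_right hle]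
      rw [← mul_assoc]
      exact mul_le_mul_of_nonneg_left hle' (mul_nonneg (hq _ _ hiv) (hq _ _ hjv))
    · refine ⟨q i j * w', ?_, .cons (by simp [hi]) (by simp [hj]) h hw'⟩
      simp only [max_eq_left hle]
      exact mul_le_mul_of_nonneg_left hle' (hq _ _ h)

theorem exists_balancing {ι : Type} [DecidableEq ι] (S : Finset ι) :
    ∀ q : ι → ι → ℝ, (∀ i j, i ≠ j → 0 ≤ q i j) →
    (∀ i w, BWalk S q i i w → w < 1) →
    ∃ α : ι → ℝ, (∀ i, 0 < α i) ∧ ∀ i ∈ S, ∀ j ∈ S, i ≠ j → α i * q i j < α j := by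
  induction S using Finset.induction_on with
  | empty => exact fun q _ _ => ⟨fun _ => 1, by simp, by simp⟩
  | insert v T hv ih =>
    intro q hq hc
    obtain ⟨α, hpos, hα⟩ := ih (fun i j => max (q i j) (q i v * q v j))
      (fun i j h => le_max_of_le_left (hq i j h))
      (fun i w h => by
        obtain ⟨w', h1, h2⟩ := h.elim_vertex hv hq
        exact h1.trans_lt (hc _ _ h2))
    have hiv : ∀ i ∈ T, i ≠ v := fun i hi e => hv (e ▸ hi)
    obtain ⟨L, hL0, hL1, hL2⟩ : ∃ L : ℝ, 0 ≤ L ∧ (∀ i ∈ T, α i * q i v ≤ L) ∧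
        ∀ j ∈ T, L * q v j < α j := by
      rcases T.eq_empty_or_nonempty with rfl | hT
      · exact ⟨0, le_rfl, by simp, by simp⟩
      · obtain ⟨i, hi, hmax⟩ := T.exists_max_image (fun i => α i * q i v) hT
        refine ⟨α i * q i v, mul_nonneg (hpos i).le (hq _ _ (hiv i hi)), hmax, ?_⟩
        intro j hj
        by_cases hij : i = j
        · subst hij
          have := hc i _ (.cons (by simp [hi]) (by simp) (hiv i hi)
            (.single (by simp) (by simp [hi]) (hiv i hi).symm))
          have h2 := mul_lt_mul_of_pos_left this (hpos i)
          linarith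
        · have h1 := hα i hi j hj hij
          have h2 := mul_le_mul_of_nonneg_left (le_max_right (q i j) (q i v * q v j)) (hpos i).le
          linarith
    have hev : ∀ᶠ x in nhdsWithin L (Set.Ioi L), L < x ∧ ∀ j ∈ T, x * q v j < α j := by
      refine (eventually_mem_nhdsWithin).and ?_
      refine Filter.Eventually.filter_mono nhdsWithin_le_nhds ?_
      rw [Filter.eventually_all_finset]
      intro j hj
      have hcont : ContinuousAt (fun x : ℝ => x * q v j) L := by fun_prop
      exact hcont.eventually_lt continuousAt_const (hL2 j hj)
    obtain ⟨x, hx, hxj⟩ := hev.exists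
    refine ⟨Function.update α v x, ?_, ?_⟩
    · intro i
      by_cases h : i = v
      · subst h; simpa using hL0.trans_lt hx
      · simpa [h] using hpos i
    · intro i hi j hj hij
      rcases Finset.mem_insert.1 hi with rfl | hiT
      · rcases Finset.mem_insert.1 hj with rfl | hj
        · exact absurd rfl hij
        · simpa [hij.symm] using hxj j hj
      · rcases Finset.mem_insert.1 hj with rfl | hj
        · simpa [hij] using (hL1 i hiT).trans_lt hx
        · have h1 := hα i hiT j hj hij
          have h2 := mul_le_mul_of_nonneg_left (le_max_left (q i j) (q i v * q v j)) (hpos i).le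
          simpa [hiv i hiT, hiv j hj] using h2.trans_lt h1

theorem BWalk.to_seq {ι : Type} {S : Finset ι} {q : ι → ι → ℝ} {i j : ι} {w : ℝ}
    (h : BWalk S q i j w) : ∃ (n : ℕ) (f : ℕ → ι), f 0 = i ∧ f (n + 1) = j ∧
      (∀ s < n + 1, f s ≠ f (s + 1)) ∧ w = ∏ s ∈ Finset.range (n + 1), q (f s) (f (s + 1)) := by
  induction h with
  | @single i j hi hj h =>
    refine ⟨0, fun n => Nat.casesOn n i (fun _ => j), rfl, rfl, ?_, by simp⟩
    intro s hs
    obtain rfl : s = 0 := by omega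
    exact h
  | @cons i j k w hi hj h hw ih =>
    obtain ⟨n, f, h0, h1, h2, h3⟩ := ih
    refine ⟨n + 1, fun n => Nat.casesOn n i f, rfl, h1, ?_, ?_⟩
    · intro s hs
      cases s with
      | zero => simpa [h0] using h
      | succ s => exact h2 s (by omega)
    · rw [Finset.prod_range_succ', h3, mul_comm]
      simp [h0]

/-- A system of strict inequalities `α i * q i j < α j` (for `i ≠ j`) with
nonnegative coefficients `q` has a positive solution `α` iff the product of the `q`'s along
every nontrivial cycle is `< 1`.  Cycles of length `n ≥ 2` are encoded by maps
`Fin (n + 2) → Fin r` with cyclic successor `s + 1` (wrapping around). -/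
theorem admissible_balancing_vector_exists_iff
    (r : ℕ) (hr : 2 ≤ r) (q : Fin r → Fin r → ℝ)
    (hq : ∀ i j : Fin r, i ≠ j → 0 ≤ q i j) :
    (∃ α : Fin r → ℝ, (∀ i, 0 < α i) ∧ ∀ i j : Fin r, i ≠ j → α i * q i j < α j) ↔
    (∀ n : ℕ, ∀ idx : Fin (n + 2) → Fin r,
      (∀ s : Fin (n + 2), idx s ≠ idx (s + 1)) →
      ∏ s : Fin (n + 2), q (idx s) (idx (s + 1)) < 1) := by
  constructor
  · rintro ⟨α, hpos, hα⟩ n idx hidx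
    by_cases hz : ∃ s, q (idx s) (idx (s + 1)) = 0
    · obtain ⟨s, hs⟩ := hz
      rw [Finset.prod_eq_zero (Finset.mem_univ s) hs]
      exact one_pos
    · push Not at hz
      have h1 : ∏ s, (α (idx s) * q (idx s) (idx (s + 1))) < ∏ s, α (idx (s + 1)) := by
        apply Finset.prod_lt_prod_of_nonempty
        · intro s _
          exact mul_pos (hpos _) (lt_of_le_of_ne (hq _ _ (hidx s)) (hz s).symm)
        · intro s _
          exact hα _ _ (hidx s)
        · exact Finset.univ_nonempty
      have h2 : ∏ s, α (idx (s + 1)) = ∏ s, α (idx s) :=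
        Equiv.prod_comp (Equiv.addRight (1 : Fin (n + 2))) (fun s => α (idx s))
      have h3 : 0 < ∏ s, α (idx s) := Finset.prod_pos fun s _ => hpos _
      rw [Finset.prod_mul_distrib, h2] at h1
      by_contra hcon
      push Not at hcon
      nlinarith
  · intro H
    obtain ⟨α, hpos, hα⟩ := exists_balancing Finset.univ q hq (by
      intro i w hw
      obtain ⟨n, f, h0, h1, h2, h3⟩ := hw.to_seq
      cases n with
      | zero => exact absurd (h0.trans h1.symm) (h2 0 (by omega))
      | succ m =>
        have key : ∀ s : Fin (m + 2), f ((s + 1 : Fin (m + 2)) : ℕ) = f ((s : ℕ) + 1) := by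
          intro s
          rw [Fin.val_add_one]
          split_ifs with hs
          · subst hs
            rw [h0]; exact h1.symm
          · rfl
        have := H m (fun s => f s) (fun s => by
          simp only [key]; exact h2 s s.isLt)
        simp only [key] at this
        rw [Fin.prod_univ_eq_prod_range (fun s => q (f s) (f (s + 1)))] at this
        rw [h3]; exact this)
    exact ⟨α, hpos, fun i j h => hα i (Finset.mem_univ _) j (Finset.mem_univ _) h⟩
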